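/- arXiv:2106.01652 — 2 statements merged into one kernel-verified Lean document; each statement's English description precedes it below -/
import Mathlib

section
/- Push-backward lemma: let A be the earliest-arrival schedule with start time a₀ ≥ e 0, and suppose A k ≤ l k for all k ≤ n. Let B₀ be a real number with 0 ≤ B₀ ≤ a₀ − e 0, let A' be the earliest-arrival schedule with start time a₀ − B₀, and define B recursively by B (k+1) = min (B k) (A (k+1) − e (k+1)). Then for every k ≤ n one has A' k = A k − B k, and consequently e k ≤ A' k ≤ A k ≤ l k for all k ≤ n, so the new schedule A' is time-window feasible. -/
/-- The earliest-arrival schedule along a path with earliest times `e`, service times `s`,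
travel times `t`, and start time `a₀`:  `A 0 = a₀` and
`A (k+1) = max (e (k+1)) (A k + s k + t k)`. -/
noncomputable def sched (e s t : ℕ → ℝ) (a₀ : ℝ) : ℕ → ℝ
  | 0 => a₀
  | k + 1 => max (e (k + 1)) (sched e s t a₀ k + s k + t k)

/-- The push-backward values: `B 0 = B₀` and `B (k+1) = min (B k) (A (k+1) − e (k+1))`. -/
noncomputable def pushB (A e : ℕ → ℝ) (B₀ : ℝ) : ℕ → ℝ
  | 0 => B₀
  | k + 1 => min (pushB A e B₀ k) (A (k + 1) - e (k + 1))

theorem le_sched {e s t : ℕ → ℝ} {a₀ : ℝ} (ha : e 0 ≤ a₀) : ∀ k, e k ≤ sched e s t a₀ k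
  | 0 => ha
  | _ + 1 => le_max_left _ _

theorem pushB_nonneg {A e : ℕ → ℝ} {B₀ : ℝ} (hB₀ : 0 ≤ B₀) (hA : ∀ k, e k ≤ A k) :
    ∀ k, 0 ≤ pushB A e B₀ k
  | 0 => hB₀
  | k + 1 => le_min (pushB_nonneg hB₀ hA k) (sub_nonneg.2 (hA (k + 1)))

theorem sched_sub_eq_sub_pushB {e s t : ℕ → ℝ} {a₀ B₀ : ℝ} (ha : e 0 ≤ a₀) (hB₀ : 0 ≤ B₀) (k : ℕ) :
    sched e s t (a₀ - B₀) k = sched e s t a₀ k - pushB (sched e s t a₀) e B₀ k := by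
  induction k with
  | zero => rfl
  | succ k ih =>
    have hB := pushB_nonneg hB₀ (le_sched (s := s) (t := t) ha) k
    simp only [sched, pushB, ih]
    grind

/-- Push-backward lemma: decreasing the start time of a time-window-feasible
earliest-arrival schedule by `B₀` yields `A' k = A k − B k`, and the new schedule
satisfies `e k ≤ A' k ≤ A k ≤ l k` for all `k ≤ n`. -/
theorem push_backward (e l s t : ℕ → ℝ) (n : ℕ) (a₀ B₀ : ℝ)
    (hs : ∀ k, 0 ≤ s k) (ht : ∀ k, 0 ≤ t k)
    (ha : e 0 ≤ a₀)
    (hl : ∀ k ≤ n, sched e s t a₀ k ≤ l k)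
    (hB₀ : 0 ≤ B₀) (hB₀' : B₀ ≤ a₀ - e 0) :
    ∀ k ≤ n,
      sched e s t (a₀ - B₀) k = sched e s t a₀ k - pushB (sched e s t a₀) e B₀ k ∧
      e k ≤ sched e s t (a₀ - B₀) k ∧
      sched e s t (a₀ - B₀) k ≤ sched e s t a₀ k ∧
      sched e s t a₀ k ≤ l k := by
  intro k hk
  have hB := pushB_nonneg hB₀ (le_sched (s := s) (t := t) ha) k
  have h := sched_sub_eq_sub_pushB (s := s) (t := t) ha hB₀ k
  exact ⟨h, le_sched (by linarith) k, by linarith, hl k hk⟩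
end

section
/- Push-forward lemma: let A be the earliest-arrival schedule with start time a₀ ≥ e 0, and suppose e k ≤ A k ≤ l k for all k ≤ n. Let F₀ ≥ 0, let A' be the earliest-arrival schedule with start time a₀ + F₀, define the waiting times W (k+1) = max 0 (e (k+1) − (A k + s k + t k)), and define F recursively by F (k+1) = max (F k − W (k+1)) 0. Then for every k ≤ n one has A' k = A k + F k; consequently the schedule A' is time-window feasible if and only if A k + F k ≤ l k for all k ≤ n; and if F m = 0 for some m ≤ n then A' k = A k for all k with m ≤ k ≤ n. -/
/-- The push-forward values: `F 0 = F₀` and `F (k+1) = max (F k − W (k+1)) 0`, where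
`W (k+1) = max 0 (e (k+1) − (A k + s k + t k))` is the waiting time at node `k+1`. -/
noncomputable def pushF (A e s t : ℕ → ℝ) (F₀ : ℝ) : ℕ → ℝ
  | 0 => F₀
  | k + 1 => max (pushF A e s t F₀ k - max 0 (e (k + 1) - (A k + s k + t k))) 0

theorem pushF_nonneg (A e s t : ℕ → ℝ) {F₀ : ℝ} (hF₀ : 0 ≤ F₀) :
    ∀ k, 0 ≤ pushF A e s t F₀ k
  | 0 => hF₀
  | _ + 1 => le_max_right _ _

theorem sched_add_start (e s t : ℕ → ℝ) (a₀ : ℝ) {F₀ : ℝ} (hF₀ : 0 ≤ F₀) (k : ℕ) :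
    sched e s t (a₀ + F₀) k = sched e s t a₀ k + pushF (sched e s t a₀) e s t F₀ k := by
  induction k with
  | zero => rfl
  | succ k ih =>
    have h := pushF_nonneg (sched e s t a₀) e s t hF₀ k
    simp only [sched, pushF, ih]
    grind

theorem pushF_eq_zero_of_le (A e s t : ℕ → ℝ) (F₀ : ℝ) {m k : ℕ} (hmk : m ≤ k)
    (hm : pushF A e s t F₀ m = 0) : pushF A e s t F₀ k = 0 := by
  induction k, hmk using Nat.le_induction with
  | base => exact hm
  | succ k _ ih => simp [pushF, ih]

/-- Push-forward lemma: increasing the start time of a time-window-feasible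
earliest-arrival schedule by `F₀ ≥ 0` yields `A' k = A k + F k`; the new schedule is
time-window feasible iff `A k + F k ≤ l k` for all `k ≤ n`; and if `F m = 0` for some
`m ≤ n` then `A' k = A k` for all `m ≤ k ≤ n`. -/
theorem push_forward (e l s t : ℕ → ℝ) (n : ℕ) (a₀ F₀ : ℝ)
    (hs : ∀ k, 0 ≤ s k) (ht : ∀ k, 0 ≤ t k)
    (ha : e 0 ≤ a₀)
    (hfeas : ∀ k ≤ n, e k ≤ sched e s t a₀ k ∧ sched e s t a₀ k ≤ l k)
    (hF₀ : 0 ≤ F₀) :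
    (∀ k ≤ n,
      sched e s t (a₀ + F₀) k = sched e s t a₀ k + pushF (sched e s t a₀) e s t F₀ k) ∧
    ((∀ k ≤ n, e k ≤ sched e s t (a₀ + F₀) k ∧ sched e s t (a₀ + F₀) k ≤ l k) ↔
      (∀ k ≤ n, sched e s t a₀ k + pushF (sched e s t a₀) e s t F₀ k ≤ l k)) ∧
    (∀ m ≤ n, pushF (sched e s t a₀) e s t F₀ m = 0 →
      ∀ k, m ≤ k → k ≤ n → sched e s t (a₀ + F₀) k = sched e s t a₀ k) := by
  have key := sched_add_start e s t a₀ hF₀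
  refine ⟨fun k _ => key k, ⟨fun h k hk => key k ▸ (h k hk).2, fun h k hk => ?_⟩,
    fun m _ hm k hmk _ => ?_⟩
  · rw [key k]
    exact ⟨le_add_of_le_of_nonneg (hfeas k hk).1 (pushF_nonneg _ e s t hF₀ k), h k hk⟩
  · rw [key k, pushF_eq_zero_of_le _ e s t F₀ hmk hm, add_zero]
end
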